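/- arXiv:1210.6795 — 2 statements merged into one kernel-verified Lean document; each statement's English description precedes it below -/
import Mathlib

section
/- Let W: ℝ^N → (−∞, +∞] be symmetric (W(−x) = W(x)), lower semicontinuous, bounded from below, with W(0) < +∞. Let μ ∈ P(ℝ^N) be a local minimizer of the interaction energy E_W with respect to d_∞ with E_W[μ] < +∞. Let Ω ⊆ supp(μ) be a connected domain, π: Ω → Ω a Borel map, and μ = m₁μ₁ + m₂μ₂ a convex combination (m₁, m₂ ≥ 0, m₁ + m₂ = 1, μ₁, μ₂ ∈ P(ℝ^N)) with supp(μ₁) ⊂ Ω. Then E_W[m₁(π#μ₁) + m₂μ₂] − E_W[m₁μ₁ + m₂μ₂] = m₁² · T_W[π#μ₁, μ₁], where π#μ₁ denotes the push-forward of μ₁ by π. -/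
open MeasureTheory Metric Set Filter
open scoped ENNReal NNReal Topology

noncomputable section

/-- `ℝ^N` with the Euclidean structure. -/
abbrev Euc (N : ℕ) := EuclideanSpace ℝ (Fin N)

/-- The positive part of an extended real number, as an element of `ℝ≥0∞`. -/
def erealPos (x : EReal) : ℝ≥0∞ := if x = ⊤ then ⊤ else ENNReal.ofReal x.toReal

/-- Extended integral of an `EReal`-valued function: the integral of the positive part minus
the integral of the negative part. -/
def eint {X : Type*} [MeasurableSpace X] (μ : Measure X) (f : X → EReal) : EReal :=
  ((∫⁻ x, erealPos (f x) ∂μ : ℝ≥0∞) : EReal) - ((∫⁻ x, erealPos (-(f x)) ∂μ : ℝ≥0∞) : EReal)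

/-- The support of a measure: the points all of whose balls have positive measure. -/
def msupp {X : Type*} [PseudoMetricSpace X] [MeasurableSpace X] (μ : Measure X) : Set X :=
  {x | ∀ ε > 0, 0 < μ (ball x ε)}

/-- The set `Π(μ,ν)` of transference plans between two measures. -/
def plans {X : Type*} [MeasurableSpace X] (μ ν : Measure X) : Set (Measure (X × X)) :=
  {π | IsProbabilityMeasure π ∧ π.map Prod.fst = μ ∧ π.map Prod.snd = ν}

/-- The `∞`-Wasserstein distance
`d_∞(μ,ν) = inf_{π ∈ Π(μ,ν)} sup_{(x,y) ∈ supp π} |x-y|`. -/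
def dInfty {X : Type*} [PseudoMetricSpace X] [MeasurableSpace X] (μ ν : Measure X) : ℝ≥0∞ :=
  ⨅ π ∈ plans μ ν, ⨆ p ∈ msupp π, edist p.1 p.2

/-- The interaction bilinear form `B_W[μ,ν] = (1/2)∬ W(x-y) dμ(x) dν(y)`. -/
def Bform {N : ℕ} (W : Euc N → EReal) (μ ν : Measure (Euc N)) : EReal :=
  ((2⁻¹ : ℝ) : EReal) * eint (μ.prod ν) (fun p => W (p.1 - p.2))

/-- The interaction energy `E_W[μ] = (1/2)∬ W(x-y) dμ(x) dμ(y)`. -/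
def interEnergy {N : ℕ} (W : Euc N → EReal) (μ : Measure (Euc N)) : EReal :=
  Bform W μ μ

/-- `T_W[μ,ν] = E_W[μ] - 2 B_W[μ,ν] + E_W[ν]`. -/
def Tform {N : ℕ} (W : Euc N → EReal) (μ ν : Measure (Euc N)) : EReal :=
  Bform W μ μ - ((2 : ℝ) : EReal) * Bform W μ ν + Bform W ν ν

/-- `μ` is a local minimizer of `E_W` with respect to the `d_∞` topology. -/
def IsLocalMinEnergy {N : ℕ} (W : Euc N → EReal) (μ : Measure (Euc N)) : Prop :=
  ∃ δ : ℝ≥0∞, 0 < δ ∧ ∀ ν : Measure (Euc N), IsProbabilityMeasure ν →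
    dInfty μ ν < δ → interEnergy W μ ≤ interEnergy W ν

/-- `V_μ = W ∗ μ`, i.e. `V_μ(x) = ∫ W(x-y) dμ(y)`. -/
def Wconv {N : ℕ} (W : Euc N → EReal) (μ : Measure (Euc N)) (x : Euc N) : EReal :=
  eint μ (fun y => W (x - y))

/-- Average of an `EReal`-valued function over the ball `B(x,r)`. -/
def ballAvg {N : ℕ} (x : Euc N) (r : ℝ) (f : Euc N → EReal) : EReal :=
  (((volume (ball x r)).toReal⁻¹ : ℝ) : EReal) * eint (volume.restrict (ball x r)) f

/-- The approximate Laplacian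
`Δ^ε W(x) = (2(N+2)/ε²) (⨍_{B(0,ε)} W(x+y) dy - W(x))`. -/
def approxLap {N : ℕ} (W : Euc N → EReal) (ε : ℝ) (x : Euc N) : EReal :=
  ((2 * (N + 2) / ε ^ 2 : ℝ) : EReal) * (ballAvg 0 ε (fun y => W (x + y)) - W x)

/-- The negative generalized Laplacian `-Δ⁰W(x) = liminf_{n→∞} (-Δ^{1/n} W(x))`. -/
def negGenLap {N : ℕ} (W : Euc N → EReal) (x : Euc N) : EReal :=
  Filter.liminf (fun n : ℕ => -approxLap W (1 / n) x) Filter.atTop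

/-- `W` is `β`-repulsive at the origin: `-Δ⁰W(x) ≥ C/|x|^β` near `0`, and `-Δ⁰W(0) = +∞`. -/
def IsBetaRepulsive {N : ℕ} (W : Euc N → EReal) (β : ℝ) : Prop :=
  (∃ ε > 0, ∃ C > 0, ∀ x : Euc N, x ≠ 0 → ‖x‖ < ε →
    ((C / ‖x‖ ^ β : ℝ) : EReal) ≤ negGenLap W x) ∧ negGenLap W 0 = ⊤

lemma erealPos_eq_toENNReal (x : EReal) : erealPos x = x.toENNReal := by
  unfold erealPos EReal.toENNReal; rfl

/-- The potential `y ↦ ∫ w (y - z) dμ(z)` generated by `μ` for a kernel `w ≥ 0`. -/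
def potential {N : ℕ} (w : Euc N → ℝ≥0∞) (μ : Measure (Euc N)) (x : Euc N) : ℝ≥0∞ :=
  ∫⁻ y, w (x - y) ∂μ

/-- The double integral `∬ w (x - y) dν(y) dμ(x)` for a kernel `w ≥ 0`. -/
def mutualEnergy {N : ℕ} (w : Euc N → ℝ≥0∞) (μ ν : Measure (Euc N)) : ℝ≥0∞ :=
  ∫⁻ x, potential w ν x ∂μ

section Kernel

variable {N : ℕ} {w : Euc N → ℝ≥0∞}

lemma measurable_potential (hw : Measurable w) (μ : Measure (Euc N)) [SFinite μ] :
    Measurable (potential w μ) :=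
  (hw.comp (measurable_fst.sub measurable_snd)).lintegral_prod_right'

lemma lowerSemicontinuous_potential (hw : LowerSemicontinuous w) (μ : Measure (Euc N)) :
    LowerSemicontinuous (potential w μ) := by
  rw [lowerSemicontinuous_iff_isClosed_preimage]
  intro c
  refine IsSeqClosed.isClosed fun u x hu hux => ?_
  have hm : ∀ n, Measurable fun y => w (u n - y) := fun n =>
    hw.measurable.comp (measurable_const.sub measurable_id)
  calc potential w μ x ≤ ∫⁻ y, liminf (fun n => w (u n - y)) atTop ∂μ := by
        refine lintegral_mono fun y => ?_
        have h : Tendsto (fun n => u n - y) atTop (𝓝 (x - y)) := hux.sub_const y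
        refine le_of_forall_lt fun b hb => ?_
        obtain ⟨b', hb, hb'⟩ := exists_between hb
        exact hb.trans_le <| le_liminf_of_le (by isBoundedDefault)
          ((h.eventually (hw (x - y) b' hb')).mono fun n hn => hn.le)
    _ ≤ liminf (fun n => potential w μ (u n)) atTop := lintegral_liminf_le hm
    _ ≤ c := liminf_le_of_frequently_le'
        (Frequently.of_forall fun n => hu n)

lemma mutualEnergy_add_left (μ ν ρ : Measure (Euc N)) :
    mutualEnergy w (μ + ν) ρ = mutualEnergy w μ ρ + mutualEnergy w ν ρ :=
  lintegral_add_measure _ _ _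

lemma mutualEnergy_smul_left (a : ℝ≥0∞) (μ ρ : Measure (Euc N)) :
    mutualEnergy w (a • μ) ρ = a * mutualEnergy w μ ρ :=
  lintegral_smul_measure _ _

lemma mutualEnergy_comm (hw : Measurable w) (hsymm : ∀ x, w (-x) = w x)
    (μ ν : Measure (Euc N)) [SFinite μ] [SFinite ν] :
    mutualEnergy w μ ν = mutualEnergy w ν μ := by
  unfold mutualEnergy potential
  rw [lintegral_lintegral_swap
    (f := fun x y => w (x - y)) (hw.comp (measurable_fst.sub measurable_snd)).aemeasurable]
  refine lintegral_congr fun y => lintegral_congr fun x => ?_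
  rw [← hsymm, neg_sub]

lemma mutualEnergy_add_self (hw : Measurable w) (hsymm : ∀ x, w (-x) = w x)
    (μ ν : Measure (Euc N)) [SFinite μ] [SFinite ν] :
    mutualEnergy w (μ + ν) (μ + ν)
      = mutualEnergy w μ μ + 2 * mutualEnergy w ν μ + mutualEnergy w ν ν := by
  rw [mutualEnergy_add_left, mutualEnergy_comm hw hsymm μ, mutualEnergy_comm hw hsymm ν,
    mutualEnergy_add_left, mutualEnergy_add_left, mutualEnergy_comm hw hsymm μ ν]
  ring

lemma mutualEnergy_smul_smul (hw : Measurable w) (hsymm : ∀ x, w (-x) = w x)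
    (a b : ℝ≥0∞) (μ ν : Measure (Euc N)) [SFinite μ] [SFinite ν] :
    mutualEnergy w (a • μ) (b • ν) = a * b * mutualEnergy w μ ν := by
  rw [mutualEnergy_smul_left, mutualEnergy_comm hw hsymm, mutualEnergy_smul_left,
    mutualEnergy_comm hw hsymm, mul_assoc]

lemma mutualEnergy_dirac_left (hw : Measurable w) (x : Euc N) (ρ : Measure (Euc N)) [SFinite ρ] :
    mutualEnergy w (Measure.dirac x) ρ = potential w ρ x :=
  lintegral_dirac' _ (measurable_potential hw ρ)

lemma mutualEnergy_dirac_dirac (hw : Measurable w) (x : Euc N) :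
    mutualEnergy w (Measure.dirac x) (Measure.dirac x) = w 0 := by
  rw [mutualEnergy_dirac_left hw, potential,
    lintegral_dirac' (f := fun y => w (x - y)) _ (hw.comp (measurable_const.sub measurable_id)),
    sub_self]

end Kernel

section Support

variable {X : Type*} [PseudoMetricSpace X] [MeasurableSpace X]

lemma measure_compl_msupp [SecondCountableTopology X] (μ : Measure X) : μ (msupp μ)ᶜ = 0 := by
  refine measure_null_of_locally_null _ fun x hx => ?_
  simp only [msupp, mem_compl_iff, mem_ofPred_eq, not_forall, not_lt, nonpos_iff_eq_zero] at hx
  obtain ⟨ε, hε, h⟩ := hx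
  exact ⟨ball x ε, mem_nhdsWithin_of_mem_nhds (ball_mem_nhds x hε), h⟩

lemma msupp_subset_of_isClosed (μ : Measure X) {s : Set X} (hs : IsClosed s) (h : μ sᶜ = 0) :
    msupp μ ⊆ s := by
  intro x hx
  by_contra hxs
  obtain ⟨ε, hε, hsub⟩ := Metric.isOpen_iff.1 hs.isOpen_compl x hxs
  exact (hx ε hε).ne' (measure_mono_null hsub h)

lemma dInfty_le_of_plan {μ ν : Measure X} {p : Measure (X × X)} (hp : p ∈ plans μ ν) {r : ℝ≥0∞}
    (h : p {q | edist q.1 q.2 ≤ r}ᶜ = 0) : dInfty μ ν ≤ r := by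
  refine (iInf₂_le p hp).trans (iSup₂_le fun q hq => ?_)
  exact msupp_subset_of_isClosed p
    (isClosed_le (continuous_fst.edist continuous_snd) continuous_const) h hq

lemma dInfty_concentrate_le [SecondCountableTopology X] [BorelSpace X] (ρ σ : Measure X)
    [IsProbabilityMeasure (ρ + σ)] (x : X) {r : ℝ≥0∞} (h : ∀ᵐ y ∂σ, edist y x ≤ r) :
    dInfty (ρ + σ) (ρ + σ univ • Measure.dirac x) ≤ r := by
  have hd : Measurable fun y : X => (y, y) := measurable_id.prodMk measurable_id
  have hc : Measurable fun y : X => (y, x) := measurable_id.prodMk measurable_const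
  have hfst : (ρ.map (fun y => (y, y)) + σ.map (fun y => (y, x))).map Prod.fst = ρ + σ := by
    rw [Measure.map_add _ _ measurable_fst, Measure.map_map measurable_fst hd,
      Measure.map_map measurable_fst hc]
    exact congrArg₂ _ Measure.map_id Measure.map_id
  have hsnd : (ρ.map (fun y => (y, y)) + σ.map (fun y => (y, x))).map Prod.snd
      = ρ + σ univ • Measure.dirac x := by
    rw [Measure.map_add _ _ measurable_snd, Measure.map_map measurable_snd hd,
      Measure.map_map measurable_snd hc]
    exact congrArg₂ _ Measure.map_id (Measure.map_const σ x)
  have hs : MeasurableSet {q : X × X | edist q.1 q.2 ≤ r} :=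
    (isClosed_le (continuous_fst.edist continuous_snd) continuous_const).measurableSet
  refine dInfty_le_of_plan (p := ρ.map (fun y => (y, y)) + σ.map (fun y => (y, x)))
    ⟨⟨?_⟩, hfst, hsnd⟩ ?_
  · rw [← measure_univ (μ := ρ + σ), ← hfst, Measure.map_apply measurable_fst .univ, preimage_univ]
  · rw [Measure.add_apply, Measure.map_apply hd hs.compl, Measure.map_apply hc hs.compl]
    have h1 : (fun y : X => (y, y)) ⁻¹' {q : X × X | edist q.1 q.2 ≤ r}ᶜ = ∅ := by
      ext y; simp
    rw [h1, measure_empty, zero_add]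
    exact h

end Support

section LocalMin

variable {N : ℕ} {w : Euc N → ℝ≥0∞} {μ : Measure (Euc N)}

/-- Moving a small multiple of `μ|_A` to a nearby point does not decrease the energy. -/
lemma setLIntegral_potential_le (hw : Measurable w) (hsymm : ∀ x, w (-x) = w x) (hw0 : w 0 ≠ ⊤)
    [IsProbabilityMeasure μ] (hfin : mutualEnergy w μ μ ≠ ⊤) {δ : ℝ≥0∞}
    (hmin : ∀ ν : Measure (Euc N), IsProbabilityMeasure ν → dInfty μ ν < δ →
      mutualEnergy w μ μ ≤ mutualEnergy w ν ν)
    {A : Set (Euc N)} (hA : MeasurableSet A) {x : Euc N} {r : ℝ≥0∞} (hr : r < δ)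
    (hAx : ∀ y ∈ A, edist y x ≤ r) :
    ∫⁻ y in A, potential w μ y ∂μ ≤ μ A * potential w μ x := by
  set α := μ.restrict A with hα
  set K := μ A ^ 2 * w 0 + mutualEnergy w α α with hK
  have hle : ∀ {ρ σ : Measure (Euc N)} [SFinite ρ] [SFinite σ], μ = ρ + σ →
      mutualEnergy w ρ ρ ≠ ⊤ ∧ mutualEnergy w σ σ ≠ ⊤ := by
    intro ρ σ _ _ h
    rw [h, mutualEnergy_add_self hw hsymm] at hfin
    constructor <;> intro h <;> exact hfin (by simp [h])
  have hμα : μ = μ.restrict Aᶜ + α := by rw [add_comm, Measure.restrict_add_restrict_compl hA]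
  have hKfin : K ≠ ⊤ := ENNReal.add_ne_top.2
    ⟨ENNReal.mul_ne_top (ENNReal.pow_ne_top (measure_ne_top μ A)) hw0, (hle hμα).2⟩
  have key : ∀ t : ℝ≥0, 0 < t → t ≤ 1 →
      2 * mutualEnergy w α μ ≤ 2 * (μ A * potential w μ x) + t * K := by
    intro t ht ht1
    set σ := (t : ℝ≥0∞) • α with hσ
    set ρ := μ.restrict Aᶜ + ((1 - t : ℝ≥0) : ℝ≥0∞) • α with hρ
    have hsum : μ = ρ + σ := by
      rw [hρ, hσ, add_assoc, ← add_smul, ← ENNReal.coe_add, tsub_add_cancel_of_le ht1,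
        ENNReal.coe_one, one_smul, ← hμα]
    have : IsProbabilityMeasure (ρ + σ) := hsum ▸ inferInstance
    have : IsFiniteMeasure σ := Measure.smul_finite α ENNReal.coe_ne_top
    have : IsFiniteMeasure (((1 - t : ℝ≥0) : ℝ≥0∞) • α) := Measure.smul_finite α ENNReal.coe_ne_top
    have : IsFiniteMeasure ρ := by rw [hρ]; infer_instance
    have hσu : σ univ = t * μ A := by simp [hσ, hα]
    have hclose : ∀ᵐ y ∂σ, edist y x ≤ r := by
      refine Measure.ae_smul_measure ?_ _
      exact (ae_restrict_iff' hA).2 (.of_forall hAx)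
    have hd := dInfty_concentrate_le ρ σ x hclose
    rw [← hsum] at hd
    have hprob : IsProbabilityMeasure (ρ + σ univ • Measure.dirac x) :=
      ⟨by simpa [-measure_univ] using measure_univ (μ := ρ + σ)⟩
    have h := hmin _ hprob (hd.trans_lt hr)
    nth_rewrite 1 2 [hsum] at h
    rw [mutualEnergy_add_self hw hsymm ρ, mutualEnergy_add_self hw hsymm ρ, add_assoc, add_assoc,
      ENNReal.add_le_add_iff_left (hle hsum).1,
      mutualEnergy_smul_smul hw hsymm _ _ (Measure.dirac x) (Measure.dirac x),
      mutualEnergy_smul_left _ (Measure.dirac x),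
      mutualEnergy_dirac_left hw, mutualEnergy_dirac_dirac hw] at h
    have hmono : potential w ρ x ≤ potential w μ x := by
      refine lintegral_mono' ?_ le_rfl
      rw [hsum]
      exact Measure.le_add_right le_rfl
    have hσσ : mutualEnergy w σ σ = t * t * mutualEnergy w α α :=
      mutualEnergy_smul_smul hw hsymm _ _ _ _
    have hσμ : t * mutualEnergy w α μ = mutualEnergy w σ ρ + mutualEnergy w σ σ := by
      rw [← mutualEnergy_smul_left, ← hσ, mutualEnergy_comm hw hsymm σ μ]
      conv_lhs => rw [hsum]
      rw [mutualEnergy_add_left, mutualEnergy_comm hw hsymm ρ σ]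
    have ht0 : (t : ℝ≥0∞) ≠ 0 := by exact_mod_cast ht.ne'
    refine (ENNReal.mul_le_mul_iff_right ht0 ENNReal.coe_ne_top).1 ?_
    calc (t : ℝ≥0∞) * (2 * mutualEnergy w α μ)
        = 2 * mutualEnergy w σ ρ + mutualEnergy w σ σ + mutualEnergy w σ σ := by
          rw [mul_left_comm, hσμ]; ring
      _ ≤ 2 * (σ univ * potential w ρ x) + σ univ * σ univ * w 0 + mutualEnergy w σ σ := by
          gcongr
      _ ≤ 2 * (σ univ * potential w μ x) + σ univ * σ univ * w 0 + mutualEnergy w σ σ := by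
          gcongr
      _ = t * (2 * (μ A * potential w μ x) + t * K) := by rw [hσu, hσσ, hK]; ring
  have hlim : Tendsto (fun t : ℝ≥0 => 2 * (μ A * potential w μ x) + (t : ℝ≥0∞) * K) (𝓝[>] 0)
      (𝓝 (2 * (μ A * potential w μ x) + ((0 : ℝ≥0) : ℝ≥0∞) * K)) := by
    refine Tendsto.mono_left ?_ nhdsWithin_le_nhds
    exact tendsto_const_nhds.add (ENNReal.Tendsto.mul_const
      (ENNReal.continuous_coe.tendsto 0) (.inr hKfin))
  have h2 : 2 * mutualEnergy w α μ ≤ 2 * (μ A * potential w μ x) + ((0 : ℝ≥0) : ℝ≥0∞) * K := by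
    refine ge_of_tendsto hlim ?_
    filter_upwards [Ioc_mem_nhdsGT (zero_lt_one' ℝ≥0)] with t ht using key t ht.1 ht.2
  rw [ENNReal.coe_zero, zero_mul, add_zero] at h2
  exact (ENNReal.mul_le_mul_iff_right two_ne_zero ENNReal.ofNat_ne_top).1 h2

/-- At a `d_∞`-local minimizer the potential at a point of the support is minimal among
nearby points. -/
lemma exists_potential_le (hw : LowerSemicontinuous w) (hsymm : ∀ x, w (-x) = w x)
    (hw0 : w 0 ≠ ⊤) [IsProbabilityMeasure μ] (hfin : mutualEnergy w μ μ ≠ ⊤) {δ : ℝ≥0∞}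
    (hδ : 0 < δ)
    (hmin : ∀ ν : Measure (Euc N), IsProbabilityMeasure ν → dInfty μ ν < δ →
      mutualEnergy w μ μ ≤ mutualEnergy w ν ν) :
    ∃ r : ℝ≥0∞, 0 < r ∧ ∀ y ∈ msupp μ, ∀ x, edist y x < r →
      potential w μ y ≤ potential w μ x := by
  obtain ⟨r, hr0, hrδ⟩ := exists_between hδ
  refine ⟨r, hr0, fun y hy x hyx => le_of_forall_lt fun c hc => ?_⟩
  obtain ⟨c', hcc', hc'⟩ := exists_between hc
  refine hcc'.trans_le ?_
  set U := {z | c' < potential w μ z} ∩ Metric.eball x r with hU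
  have hUo : IsOpen U :=
    ((lowerSemicontinuous_potential hw μ).isOpen_preimage c').inter Metric.isOpen_eball
  obtain ⟨ε, hε, hsub⟩ := Metric.isOpen_iff.1 hUo y ⟨hc', hyx⟩
  have hpos : μ U ≠ 0 := ((hy ε hε).trans_le (measure_mono hsub)).ne'
  have h := setLIntegral_potential_le hw.measurable hsymm hw0 hfin hmin hUo.measurableSet hrδ
    (x := x) (fun z hz => (Metric.mem_eball.1 hz.2).le)
  refine (ENNReal.mul_le_mul_iff_right hpos (measure_ne_top μ U)).1 (le_trans ?_ h)
  rw [mul_comm, ← setLIntegral_const]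
  exact setLIntegral_mono (measurable_potential hw.measurable μ) fun z hz => hz.1.le

lemma potential_eq_of_isPreconnected {r : ℝ≥0∞} (hr : 0 < r)
    (h : ∀ y ∈ msupp μ, ∀ x, edist y x < r → potential w μ y ≤ potential w μ x)
    {Ω : Set (Euc N)} (hΩ : IsPreconnected Ω) (hsub : Ω ⊆ msupp μ) {x y : Euc N}
    (hx : x ∈ Ω) (hy : y ∈ Ω) : potential w μ x = potential w μ y := by
  refine hΩ.induction₂ (fun x y => potential w μ x = potential w μ y) (fun x hx => ?_)
    (fun _ _ _ _ _ _ => Eq.trans) (fun _ _ _ _ => Eq.symm) hx hy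
  filter_upwards [self_mem_nhdsWithin, mem_nhdsWithin_of_mem_nhds (Metric.eball_mem_nhds x hr)]
    with y hy hyx
  rw [Metric.mem_eball] at hyx
  exact le_antisymm (h x (hsub hx) y (edist_comm y x ▸ hyx)) (h y (hsub hy) x hyx)

end LocalMin

lemma toENNReal_add_toENNReal_neg {k : ℝ} (hk : 0 ≤ k) {z : EReal} (hz : ((-k : ℝ) : EReal) ≤ z) :
    ((k : EReal) + z).toENNReal + (-z).toENNReal = z.toENNReal + ENNReal.ofReal k := by
  induction z with
  | bot => simp at hz
  | top => simp
  | coe z =>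
    have hz : -k ≤ z := by exact_mod_cast hz
    rw [← EReal.coe_add, ← EReal.coe_neg]
    simp only [EReal.real_coe_toENNReal]
    rcases le_total 0 z with h | h
    · rw [ENNReal.ofReal_of_nonpos (by linarith : -z ≤ 0), add_zero, add_comm k,
        ENNReal.ofReal_add h hk]
    · rw [ENNReal.ofReal_of_nonpos h, zero_add, ← ENNReal.ofReal_add (by linarith) (by linarith)]
      congr 1; ring

lemma eint_eq_lintegral_sub {X : Type*} [MeasurableSpace X] (P : Measure X)
    [IsProbabilityMeasure P] {f : X → EReal} (hf : Measurable f) {k : ℝ} (hk : 0 ≤ k)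
    (hfk : ∀ x, ((-k : ℝ) : EReal) ≤ f x) :
    eint P f = ((∫⁻ x, ((k : EReal) + f x).toENNReal ∂P : ℝ≥0∞) : EReal) - (k : EReal) := by
  simp only [eint, erealPos_eq_toENNReal]
  have hneg : ∫⁻ x, (-f x).toENNReal ∂P ≠ ⊤ := by
    refine ne_top_of_le_ne_top (b := ENNReal.ofReal k) ENNReal.ofReal_ne_top ?_
    calc ∫⁻ x, (-f x).toENNReal ∂P ≤ ∫⁻ _, ENNReal.ofReal k ∂P := by
          refine lintegral_mono fun x => ?_
          rw [← EReal.real_coe_toENNReal]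
          exact EReal.toENNReal_le_toENNReal (EReal.neg_le_of_neg_le (by simpa using hfk x))
      _ = ENNReal.ofReal k := by simp
  have hsum : ∫⁻ x, ((k : EReal) + f x).toENNReal ∂P + ∫⁻ x, (-f x).toENNReal ∂P
      = ∫⁻ x, (f x).toENNReal ∂P + ENNReal.ofReal k := by
    rw [← lintegral_add_right (fun x => ((k : EReal) + f x).toENNReal)
      (g := fun x => (-f x).toENNReal) hf.neg.ereal_toENNReal]
    simp_rw [fun x => toENNReal_add_toENNReal_neg hk (hfk x)]
    rw [lintegral_add_right _ measurable_const]
    simp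
  generalize ∫⁻ x, ((k : EReal) + f x).toENNReal ∂P = a at *
  generalize ∫⁻ x, (-f x).toENNReal ∂P = b at *
  generalize ∫⁻ x, (f x).toENNReal ∂P = d at *
  lift b to ℝ≥0 using hneg
  induction a with
  | top =>
    have : d = ⊤ := by simpa using hsum.symm
    subst this
    rfl
  | coe a =>
    have hd : d ≠ ⊤ := by
      rintro rfl
      simp [← ENNReal.coe_add] at hsum
    lift d to ℝ≥0 using hd
    have : (a : ℝ) + b = d + k := by
      have := congrArg ENNReal.toReal hsum
      rwa [ENNReal.toReal_add (by simp) (by simp), ENNReal.toReal_add (by simp) (by simp),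
        ENNReal.toReal_ofReal hk] at this
    change (((d : ℝ) : EReal)) - ((b : ℝ) : EReal) = ((a : ℝ) : EReal) - (k : EReal)
    rw [← EReal.coe_sub, ← EReal.coe_sub]
    congr 1; linarith

lemma Bform_eq_mutualEnergy {N : ℕ} {W : Euc N → EReal} (hW : Measurable W) {k : ℝ} (hk : 0 ≤ k)
    (hWk : ∀ x, ((-k : ℝ) : EReal) ≤ W x) (μ ν : Measure (Euc N)) [IsProbabilityMeasure μ]
    [IsProbabilityMeasure ν] :
    Bform W μ ν = ((2⁻¹ : ℝ) : EReal) *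
      ((mutualEnergy (fun x => ((k : EReal) + W x).toENNReal) μ ν : EReal) - (k : EReal)) := by
  have hd : Measurable fun p : Euc N × Euc N => W (p.1 - p.2) :=
    hW.comp (measurable_fst.sub measurable_snd)
  rw [Bform, eint_eq_lintegral_sub _ hd hk fun _ => hWk _, lintegral_prod]
  · rfl
  · exact (measurable_const.add hd).ereal_toENNReal.aemeasurable

lemma half_mul_sub_le_half_mul_sub_iff {k : ℝ} {a b : ℝ≥0∞} :
    ((2⁻¹ : ℝ) : EReal) * ((a : EReal) - (k : EReal)) ≤ ((2⁻¹ : ℝ) : EReal) * ((b : EReal) - k)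
      ↔ a ≤ b := by
  induction a <;> induction b
  · simp
  · rename_i b
    simp only [EReal.coe_ennreal_top, EReal.top_sub_coe, top_le_iff, ENNReal.coe_ne_top, iff_false]
    rw [EReal.coe_mul_top_of_pos (by norm_num)]
    rw [top_le_iff]
    change ¬ (((2⁻¹ : ℝ) : EReal) * (((b : ℝ) : EReal) - k) = ⊤)
    rw [← EReal.coe_sub, ← EReal.coe_mul]
    exact EReal.coe_ne_top _
  · simp only [EReal.coe_ennreal_top, EReal.top_sub_coe, le_top, iff_true]
    rw [EReal.coe_mul_top_of_pos (by norm_num)]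
    exact le_top
  · rename_i a b
    change (((2⁻¹ : ℝ) : EReal) * (((a : ℝ) : EReal) - k)
      ≤ ((2⁻¹ : ℝ) : EReal) * (((b : ℝ) : EReal) - k)) ↔ _
    rw [← EReal.coe_sub, ← EReal.coe_mul, ← EReal.coe_sub, ← EReal.coe_mul, EReal.coe_le_coe_iff,
      ENNReal.coe_le_coe, ← NNReal.coe_le_coe]
    constructor <;> intro h <;> linarith

/-- The quadratic expansion behind the localization formula, with a possibly infinite `n`. -/
lemma half_sub_eq_sq_mul {k : ℝ} {a C p m q l s : ℝ≥0} (ha : a ≠ 0) (n : ℝ≥0∞)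
    (hp : a * p + q = C) (hm : a * m + l = C) :
    ((2⁻¹ : ℝ) : EReal) * (((a ^ 2 * n + 2 * (a * q) + s : ℝ≥0∞) : EReal) - (k : EReal))
      - ((2⁻¹ : ℝ) : EReal) * (((a ^ 2 * m + 2 * (a * l) + s : ℝ≥0∞) : EReal) - (k : EReal))
    = ((a.toReal ^ 2 : ℝ) : EReal) * (((2⁻¹ : ℝ) : EReal) * ((n : EReal) - (k : EReal))
      - ((2 : ℝ) : EReal) * (((2⁻¹ : ℝ) : EReal) * (((p : ℝ≥0∞) : EReal) - (k : EReal)))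
      + ((2⁻¹ : ℝ) : EReal) * (((m : ℝ≥0∞) : EReal) - (k : EReal))) := by
  have e : ∀ x : ℝ≥0, ((x : ℝ≥0∞) : EReal) = ((x : ℝ) : EReal) := fun _ => rfl
  have ha' : (0 : ℝ) < a := by positivity
  induction n with
  | top =>
    have h1 : ((a : ℝ≥0∞) ^ 2 * ⊤ + 2 * (a * q) + s : ℝ≥0∞) = ⊤ := by
      rw [ENNReal.mul_top (by simpa using ha)]; simp
    have h2 : ((a : ℝ≥0∞) ^ 2 * m + 2 * (a * l) + s)
        = ((a ^ 2 * m + 2 * (a * l) + s : ℝ≥0) : ℝ≥0∞) := by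
      push_cast; rfl
    rw [h1, h2]
    simp only [e, EReal.coe_ennreal_top, EReal.top_sub_coe, ← EReal.coe_sub, ← EReal.coe_mul,
      EReal.coe_mul_top_of_pos (show (0 : ℝ) < 2⁻¹ by norm_num), EReal.top_add_coe]
    rw [EReal.coe_mul_top_of_pos (by positivity)]
  | coe n =>
    have h1 : ∀ n l : ℝ≥0, ((a : ℝ≥0∞) ^ 2 * n + 2 * (a * l) + s)
        = ((a ^ 2 * n + 2 * (a * l) + s : ℝ≥0) : ℝ≥0∞) := by
      intro n l; push_cast; rfl
    rw [h1, h1]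
    simp only [e, ← EReal.coe_sub, ← EReal.coe_mul, ← EReal.coe_add]
    congr 1
    have hp' : (q : ℝ) = C - a * p := by rw [← hp]; push_cast; ring
    have hm' : (l : ℝ) = C - a * m := by rw [← hm]; push_cast; ring
    push_cast
    rw [hp', hm']
    ring

/-- localization lemma: for a symmetric l.s.c. potential bounded below with
`W(0) < ∞`, and a `d_∞`-local minimizer `μ = m₁μ₁ + m₂μ₂` with finite energy, a Borel map
`π : Ω → Ω` on a connected subdomain `Ω ⊆ supp μ` containing `supp μ₁` satisfies
`E[m₁(π#μ₁)+m₂μ₂] - E[μ] = m₁² T[π#μ₁, μ₁]`. -/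
theorem statement14 {N : ℕ} (W : Euc N → EReal)
    (hsymm : ∀ x : Euc N, W (-x) = W x) (hlsc : LowerSemicontinuous W)
    (hbdd : ∃ c : ℝ, ∀ x, ((c : ℝ) : EReal) ≤ W x) (hW0 : W 0 < ⊤)
    (μ : Measure (Euc N)) (hμ : IsProbabilityMeasure μ)
    (hmin : IsLocalMinEnergy W μ) (hfin : interEnergy W μ < ⊤)
    (Ω : Set (Euc N)) (hΩsupp : Ω ⊆ msupp μ) (hΩconn : IsConnected Ω)
    (π : Euc N → Euc N) (hπmeas : Measurable π) (hπΩ : MapsTo π Ω Ω)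
    (m₁ m₂ : ℝ≥0∞) (hm : m₁ + m₂ = 1)
    (μ₁ μ₂ : Measure (Euc N)) (h₁ : IsProbabilityMeasure μ₁) (h₂ : IsProbabilityMeasure μ₂)
    (hdecomp : μ = m₁ • μ₁ + m₂ • μ₂) (hsupp₁ : msupp μ₁ ⊆ Ω) :
    interEnergy W (m₁ • (μ₁.map π) + m₂ • μ₂) - interEnergy W (m₁ • μ₁ + m₂ • μ₂)
      = ((m₁.toReal ^ (2 : ℕ) : ℝ) : EReal) * Tform W (μ₁.map π) μ₁ := by
  have hm₁ : m₁ ≠ ⊤ := ne_top_of_le_ne_top ENNReal.one_ne_top (hm ▸ le_self_add)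
  obtain ⟨c, hc⟩ := hbdd
  set k := max (-c) 0
  have hk : 0 ≤ k := le_max_right _ _
  have hWk : ∀ x, ((-k : ℝ) : EReal) ≤ W x := fun x =>
    (EReal.coe_le_coe_iff.2 (by linarith [le_max_left (-c) 0])).trans (hc x)
  have hWm : Measurable W := hlsc.measurable
  set w : Euc N → ℝ≥0∞ := fun x => ((k : EReal) + W x).toENNReal with hw
  have hwm : Measurable w := (measurable_const.add hWm).ereal_toENNReal
  have hwsymm : ∀ x, w (-x) = w x := fun x => by simp only [hw, hsymm]
  have hwlsc : LowerSemicontinuous w := by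
    have hcont : Continuous fun z : EReal => ((k : EReal) + z).toENNReal := by
      refine EReal.continuous_toENNReal.comp (continuous_iff_continuousAt.2 fun z => ?_)
      exact (EReal.continuousAt_add (p := ((k : EReal), z)) (.inl (EReal.coe_ne_top k))
        (.inl (EReal.coe_ne_bot k))).comp (continuous_const.prodMk continuous_id).continuousAt
    exact hcont.comp_lowerSemicontinuous hlsc fun a b hab =>
      EReal.toENNReal_le_toENNReal (by gcongr)
  have hw0 : w 0 ≠ ⊤ := by
    rw [hw, EReal.toENNReal_ne_top_iff]
    exact (EReal.add_lt_top (EReal.coe_ne_top k) hW0.ne).ne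
  have hE : ∀ (ν ν' : Measure (Euc N)) [IsProbabilityMeasure ν] [IsProbabilityMeasure ν'],
      Bform W ν ν' = ((2⁻¹ : ℝ) : EReal) * ((mutualEnergy w ν ν' : EReal) - (k : EReal)) :=
    fun ν ν' _ _ => Bform_eq_mutualEnergy hWm hk hWk ν ν'
  have hμfin : mutualEnergy w μ μ ≠ ⊤ := by
    intro h
    rw [interEnergy, hE, h, EReal.coe_ennreal_top, EReal.top_sub_coe,
      EReal.coe_mul_top_of_pos (by norm_num)] at hfin
    exact lt_irrefl _ hfin
  obtain ⟨δ, hδ, hδmin⟩ := hmin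
  have hmin' : ∀ ν : Measure (Euc N), IsProbabilityMeasure ν → dInfty μ ν < δ →
      mutualEnergy w μ μ ≤ mutualEnergy w ν ν := fun ν hν hd => by
    have h := hδmin ν hν hd
    rwa [interEnergy, interEnergy, hE, hE, half_mul_sub_le_half_mul_sub_iff] at h
  obtain ⟨r, hr, hpot⟩ := exists_potential_le hwlsc hwsymm hw0 hμfin hδ hmin'
  obtain ⟨x₀, hx₀⟩ := hΩconn.nonempty
  have hconst : ∀ x ∈ Ω, potential w μ x = potential w μ x₀ := fun x hx =>
    potential_eq_of_isPreconnected hr hpot hΩconn.isPreconnected hΩsupp hx hx₀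
  have hΩae : ∀ᵐ x ∂μ₁, x ∈ Ω :=
    measure_mono_null (compl_subset_compl.2 hsupp₁) (measure_compl_msupp μ₁)
  have : IsProbabilityMeasure (μ₁.map π) := Measure.isProbabilityMeasure_map hπmeas.aemeasurable
  have hprob : IsProbabilityMeasure (m₁ • μ₁.map π + m₂ • μ₂) := ⟨by
    simpa using hm⟩
  have hπμ : mutualEnergy w (μ₁.map π) μ = potential w μ x₀ := by
    rw [mutualEnergy, lintegral_map (measurable_potential hwm μ) hπmeas,
      lintegral_congr_ae (hΩae.mono fun x hx => hconst _ (hπΩ hx))]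
    simp
  have hμ₁μ : mutualEnergy w μ₁ μ = potential w μ x₀ := by
    rw [mutualEnergy, lintegral_congr_ae (hΩae.mono fun x hx => hconst _ hx)]
    simp
  have hexp : ∀ ν : Measure (Euc N), IsProbabilityMeasure ν →
      mutualEnergy w (m₁ • ν + m₂ • μ₂) (m₁ • ν + m₂ • μ₂) = m₁ ^ 2 * mutualEnergy w ν ν
        + 2 * (m₁ * (m₂ * mutualEnergy w ν μ₂)) + m₂ ^ 2 * mutualEnergy w μ₂ μ₂ := by
    intro ν _
    rw [mutualEnergy_add_self hwm hwsymm, mutualEnergy_smul_smul hwm hwsymm,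
      mutualEnergy_smul_smul hwm hwsymm, mutualEnergy_smul_smul hwm hwsymm,
      mutualEnergy_comm hwm hwsymm μ₂ ν]
    ring
  have hlin : ∀ ν : Measure (Euc N), IsProbabilityMeasure ν →
      mutualEnergy w ν μ = m₁ * mutualEnergy w ν μ₁ + m₂ * mutualEnergy w ν μ₂ := by
    intro ν _
    rw [mutualEnergy_comm hwm hwsymm, hdecomp]
    rw [mutualEnergy_add_left, mutualEnergy_smul_left, mutualEnergy_smul_left,
      mutualEnergy_comm hwm hwsymm μ₁, mutualEnergy_comm hwm hwsymm μ₂]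
  have hprobμ : IsProbabilityMeasure (m₁ • μ₁ + m₂ • μ₂) := hdecomp ▸ hμ
  have hμself := hexp μ₁ h₁
  rw [← hdecomp] at hμself
  rw [hμself] at hμfin
  rw [Tform, interEnergy, interEnergy, hE, hE, hE, hE, hE, hexp _ this, hexp _ h₁]
  rcases eq_or_ne m₁ 0 with rfl | hm0
  · simp only [ENNReal.toReal_zero, ne_eq, OfNat.ofNat_ne_zero, not_false_eq_true,
      zero_pow, zero_mul, mul_zero, zero_add, EReal.coe_zero] at hμfin ⊢
    lift m₂ ^ 2 * mutualEnergy w μ₂ μ₂ to ℝ≥0 using hμfin with s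
    change ((2⁻¹ : ℝ) : EReal) * (((s : ℝ) : EReal) - k)
      - ((2⁻¹ : ℝ) : EReal) * (((s : ℝ) : EReal) - k) = 0
    rw [← EReal.coe_sub, ← EReal.coe_mul, ← EReal.coe_sub, sub_self, EReal.coe_zero]
  have hP := hlin _ this
  have hM := hlin _ h₁
  rw [hπμ] at hP
  rw [hμ₁μ] at hM
  have hfins : mutualEnergy w μ₁ μ₁ ≠ ⊤ ∧ m₂ * mutualEnergy w μ₁ μ₂ ≠ ⊤
      ∧ m₂ ^ 2 * mutualEnergy w μ₂ μ₂ ≠ ⊤ := by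
    refine ⟨fun h => hμfin ?_, fun h => hμfin ?_, fun h => hμfin ?_⟩ <;>
      simp [h, ENNReal.mul_top, hm0]
  obtain ⟨hMf, hRf, hSf⟩ := hfins
  have hCf : potential w μ x₀ ≠ ⊤ := by
    rw [hM]
    exact ENNReal.add_ne_top.2 ⟨ENNReal.mul_ne_top hm₁ hMf, hRf⟩
  have hQf : m₂ * mutualEnergy w (μ₁.map π) μ₂ ≠ ⊤ := fun h => hCf (by rw [hP, h, add_top])
  have hPf : mutualEnergy w (μ₁.map π) μ₁ ≠ ⊤ := fun h =>
    hCf (by rw [hP, h, ENNReal.mul_top hm0, top_add])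
  generalize potential w μ x₀ = C at *
  generalize m₂ * mutualEnergy w (μ₁.map π) μ₂ = q at *
  generalize m₂ * mutualEnergy w μ₁ μ₂ = l at *
  generalize m₂ ^ 2 * mutualEnergy w μ₂ μ₂ = s at *
  generalize mutualEnergy w (μ₁.map π) μ₁ = p at *
  generalize mutualEnergy w μ₁ μ₁ = m at *
  lift C to ℝ≥0 using hCf
  lift q to ℝ≥0 using hQf
  lift l to ℝ≥0 using hRf
  lift s to ℝ≥0 using hSf
  lift p to ℝ≥0 using hPf
  lift m to ℝ≥0 using hMf
  lift m₁ to ℝ≥0 using hm₁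
  rw [ENNReal.coe_toReal]
  exact half_sub_eq_sq_mul (by exact_mod_cast hm0) _ (by exact_mod_cast hP.symm) (by exact_mod_cast hM.symm)

end
end

section
/- Let α > 2, 1 ≤ k ≤ N, and let W(x) = w(|x|) be continuously differentiable, with w decreasing on a neighborhood of 0 and satisfying C*|w′(r)| ≤ r^{α−1} on [0,R] for some C* > 0 and R > 0. Let g ∈ C²(D^k_R, ℝ^{N−k}) with g(0) = 0 and ∇g(0) = 0, and let P_g: D^k_R → ℝ^N be the graph map P_g(x′,0) = (x′, g(x′)). Then for all sufficiently small ε > 0, T_W[δ₀, P_g#ν_{ε,k}] − T_W[δ₀, ν_{ε,k}] ≤ (2^{α−1} ε^α / C*) · ‖∇g‖_{L^∞(D^k_ε)}. -/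
open MeasureTheory Metric Set Filter
open scoped ENNReal NNReal Topology

noncomputable section

/-- The embedding `ℝ^k → ℝ^N` onto the first `k` coordinates. -/
def embedK (N k : ℕ) (x : EuclideanSpace ℝ (Fin k)) : Euc N :=
  (WithLp.equiv 2 (Fin N → ℝ)).symm (fun i =>
    if h : (i : ℕ) < k then (WithLp.equiv 2 (Fin k → ℝ)) x ⟨(i : ℕ), h⟩ else 0)

/-- `ν_{ε,k}`: the uniform probability measure on the `k`-dimensional disk
`D^k_ε = {x : x₁²+⋯+x_k² ≤ ε², x_{k+1} = ⋯ = x_N = 0}`, obtained by pushing forward the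
normalized `k`-dimensional Lebesgue measure on the closed ball of radius `ε`. -/
def diskUnif (N k : ℕ) (ε : ℝ) : Measure (Euc N) :=
  ((volume (closedBall (0 : EuclideanSpace ℝ (Fin k)) ε))⁻¹ •
    (volume : Measure (EuclideanSpace ℝ (Fin k))).restrict (closedBall 0 ε)).map (embedK N k)

/-- `h` is `λ`-convex on `s`. -/
def LambdaConvexOn (h : ℝ → ℝ) (lam : ℝ) (s : Set ℝ) : Prop :=
  ∀ r₁ ∈ s, ∀ r₂ ∈ s,
    h ((r₁ + r₂) / 2) ≤ (1 / 2) * h r₁ + (1 / 2) * h r₂ - (lam / 8) * (r₁ - r₂) ^ (2 : ℕ)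

/-- `h` is `φ`-uniformly convex on `s`. -/
def PhiConvexOn (h : ℝ → ℝ) (φ : ℝ → ℝ) (s : Set ℝ) : Prop :=
  ∀ r₁ ∈ s, ∀ r₂ ∈ s,
    h ((r₁ + r₂) / 2) ≤ (1 / 2) * (h r₁ + h r₂) - (1 / 4) * ∫ t in (0 : ℝ)..|r₁ - r₂|, φ t

/-- Projection `ℝ^N → ℝ^k` onto the first `k` coordinates. -/
def projK (N k : ℕ) (z : Euc N) : EuclideanSpace ℝ (Fin k) :=
  (WithLp.equiv 2 (Fin k → ℝ)).symm (fun j =>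
    if h : (j : ℕ) < N then (WithLp.equiv 2 (Fin N → ℝ)) z ⟨(j : ℕ), h⟩ else 0)

/-- The graph parameterization `P_g(x',0) = (x', g(x'))`, as a map `ℝ^N → ℝ^N` acting on the
first `k` coordinates. -/
def graphMap (N k : ℕ) (g : EuclideanSpace ℝ (Fin k) → EuclideanSpace ℝ (Fin (N - k)))
    (z : Euc N) : Euc N :=
  (WithLp.equiv 2 (Fin N → ℝ)).symm (fun i =>
    if h : (i : ℕ) < k then (WithLp.equiv 2 (Fin N → ℝ)) z i
    else (WithLp.equiv 2 (Fin (N - k) → ℝ)) (g (projK N k z))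
      ⟨(i : ℕ) - k, by have := i.isLt; omega⟩)

lemma eint_coe {X : Type*} [MeasurableSpace X] {μ : Measure X} {f : X → ℝ}
    (hf : Integrable f μ) : eint μ (fun x => (f x : EReal)) = ((∫ x, f x ∂μ : ℝ) : EReal) := by
  have hpos : ∀ r : ℝ, erealPos (r : EReal) = ENNReal.ofReal r := fun r => by simp [erealPos]
  have hfin : ∀ {h : X → ℝ}, Integrable h μ → ∫⁻ x, ENNReal.ofReal (h x) ∂μ ≠ ⊤ :=
    fun hh => hh.lintegral_lt_top.ne
  unfold eint
  simp only [← EReal.coe_neg, hpos]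
  rw [integral_eq_lintegral_pos_part_sub_lintegral_neg_part hf, EReal.coe_sub,
    EReal.coe_ennreal_toReal (hfin hf), EReal.coe_ennreal_toReal (hfin (h := fun x => -f x) hf.neg)]

lemma integrable_of_ae_norm_le {E : Type*} [NormedAddCommGroup E] [ProperSpace E]
    [MeasurableSpace E] [BorelSpace E] [SecondCountableTopology E] {W : E → ℝ}
    (hW : Continuous W) {X : Type*} [MeasurableSpace X] {μ : Measure X} [IsFiniteMeasure μ]
    {φ : X → E} (hφ : AEMeasurable φ μ) {M : ℝ} (hM : ∀ᵐ x ∂μ, ‖φ x‖ ≤ M) :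
    Integrable (fun x => W (φ x)) μ := by
  obtain ⟨C, hC⟩ := (isCompact_closedBall (0 : E) M).exists_bound_of_continuousOn hW.continuousOn
  refine Integrable.of_bound (hW.measurable.comp_aemeasurable hφ).aestronglyMeasurable C ?_
  filter_upwards [hM] with x hx
  exact hC _ (by simpa using hx)

lemma Bform_coe {N : ℕ} {W : Euc N → ℝ} (hW : Continuous W) {μ ν : Measure (Euc N)}
    [IsProbabilityMeasure μ] [IsProbabilityMeasure ν] {M : ℝ}
    (hμ : ∀ᵐ x ∂μ, ‖x‖ ≤ M) (hν : ∀ᵐ x ∂ν, ‖x‖ ≤ M) :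
    Bform (fun x => (W x : EReal)) μ ν
      = ((2⁻¹ * ∫ p, W (p.1 - p.2) ∂(μ.prod ν) : ℝ) : EReal) := by
  unfold Bform
  rw [eint_coe, EReal.coe_mul]
  refine integrable_of_ae_norm_le hW (φ := fun p : Euc N × Euc N => p.1 - p.2)
    (by fun_prop) (M := M + M) ?_
  filter_upwards [Measure.quasiMeasurePreserving_fst.ae hμ,
    Measure.quasiMeasurePreserving_snd.ae hν] with p h1 h2
  exact (norm_sub_le _ _).trans (add_le_add h1 h2)

lemma Tform_dirac_zero_coe {N : ℕ} {W : Euc N → ℝ} (hW : Continuous W)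
    (heven : ∀ x, W (-x) = W x) {ν : Measure (Euc N)} [IsProbabilityMeasure ν] {M : ℝ}
    (hM0 : 0 ≤ M) (hν : ∀ᵐ x ∂ν, ‖x‖ ≤ M) :
    Tform (fun x => (W x : EReal)) (Measure.dirac 0) ν
      = ((2⁻¹ * W 0 - ∫ x, W x ∂ν + 2⁻¹ * ∫ p, W (p.1 - p.2) ∂(ν.prod ν) : ℝ) : EReal) := by
  have hd : ∀ᵐ x ∂(Measure.dirac (0 : Euc N)), ‖x‖ ≤ M := by
    rw [ae_dirac_eq]; simpa using hM0
  have hc : Continuous fun p : Euc N × Euc N => W (p.1 - p.2) := hW.comp (by fun_prop)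
  unfold Tform
  rw [Bform_coe hW hd hd, Bform_coe hW hd hν, Bform_coe hW hν hν]
  rw [Measure.dirac_prod, Measure.dirac_prod,
    integral_map (by fun_prop) hc.aestronglyMeasurable,
    integral_map (by fun_prop) hc.aestronglyMeasurable]
  simp only [zero_sub, heven, integral_dirac]
  rw [← EReal.coe_mul, ← EReal.coe_sub, ← EReal.coe_add]
  congr 2
  ring

lemma Tform_map_sub_le {N : ℕ} {W : Euc N → ℝ} (hW : Continuous W)
    (heven : ∀ x, W (-x) = W x) {ν : Measure (Euc N)} [IsProbabilityMeasure ν]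
    {P : Euc N → Euc N} (hP : AEMeasurable P ν) {S : Set (Euc N)} (hS : ∀ᵐ x ∂ν, x ∈ S)
    {M K : ℝ} (hM0 : 0 ≤ M) (hM : ∀ x ∈ S, ‖x‖ ≤ M) (hPM : ∀ x ∈ S, ‖P x‖ ≤ M)
    (hpair : ∀ x ∈ S, ∀ y ∈ S, W (P x - P y) ≤ W (x - y))
    (hK : ∀ x ∈ S, W x - W (P x) ≤ K) :
    Tform (fun x => (W x : EReal)) (Measure.dirac 0) (ν.map P)
      - Tform (fun x => (W x : EReal)) (Measure.dirac 0) ν ≤ (K : EReal) := by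
  have hc : Continuous fun p : Euc N × Euc N => W (p.1 - p.2) := hW.comp (by fun_prop)
  obtain ⟨Q, hQ, hPQ⟩ := hP
  rw [Measure.map_congr hPQ]
  have : IsProbabilityMeasure (ν.map Q) := Measure.isProbabilityMeasure_map hQ.aemeasurable
  have hνM : ∀ᵐ x ∂ν, ‖x‖ ≤ M := hS.mono hM
  have hQM : ∀ᵐ x ∂ν, ‖Q x‖ ≤ M := by
    filter_upwards [hS, hPQ] with x hx h
    exact h ▸ hPM x hx
  have hQM' : ∀ᵐ x ∂(ν.map Q), ‖x‖ ≤ M :=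
    (ae_map_iff hQ.aemeasurable (measurableSet_le measurable_norm measurable_const)).2 hQM
  rw [Tform_dirac_zero_coe hW heven hM0 hQM', Tform_dirac_zero_coe hW heven hM0 hνM,
    ← EReal.coe_sub, EReal.coe_le_coe_iff, Measure.map_prod_map ν ν hQ hQ,
    integral_map hQ.aemeasurable hW.aestronglyMeasurable,
    integral_map (hQ.prodMap hQ).aemeasurable hc.aestronglyMeasurable]
  have hprod : ∀ {p : Euc N → Prop}, (∀ᵐ x ∂ν, p x) → ∀ᵐ z ∂(ν.prod ν), p z.1 ∧ p z.2 :=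
    fun h => (Measure.quasiMeasurePreserving_fst.ae h).and
      (Measure.quasiMeasurePreserving_snd.ae h)
  have h1 : ∫ z, W ((Prod.map Q Q z).1 - (Prod.map Q Q z).2) ∂(ν.prod ν)
      ≤ ∫ z, W (z.1 - z.2) ∂(ν.prod ν) := by
    refine integral_mono_ae
      (integrable_of_ae_norm_le hW (φ := fun z => (Prod.map Q Q z).1 - (Prod.map Q Q z).2)
        (((hQ.comp measurable_fst).sub (hQ.comp measurable_snd)).aemeasurable) (M := M + M) ?_)
      (integrable_of_ae_norm_le hW (φ := fun z : Euc N × Euc N => z.1 - z.2)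
        (by fun_prop) (M := M + M) ?_) ?_
    · filter_upwards [hprod hQM] with z hz
      exact (norm_sub_le _ _).trans (add_le_add hz.1 hz.2)
    · filter_upwards [hprod hνM] with z hz
      exact (norm_sub_le _ _).trans (add_le_add hz.1 hz.2)
    · filter_upwards [hprod hS, hprod hPQ] with z hz hz'
      simpa [← hz'.1, ← hz'.2] using hpair _ hz.1 _ hz.2
  have hi1 : Integrable W ν := integrable_of_ae_norm_le hW aemeasurable_id hνM
  have hi2 : Integrable (fun x => W (Q x)) ν :=
    integrable_of_ae_norm_le hW hQ.aemeasurable hQM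
  have h2 : ∫ x, W x ∂ν - ∫ x, W (Q x) ∂ν ≤ K := by
    rw [← integral_sub hi1 hi2]
    calc ∫ x, (W x - W (Q x)) ∂ν ≤ ∫ _, K ∂ν := by
          refine integral_mono_ae (hi1.sub hi2) (integrable_const K) ?_
          filter_upwards [hS, hPQ] with x hx h
          simpa [← h] using hK x hx
      _ = K := by simp
  linarith

lemma continuous_embedK (N k : ℕ) : Continuous (embedK N k) := by
  refine (PiLp.continuous_toLp 2 _).comp (continuous_pi fun i => ?_)
  by_cases h : (i : ℕ) < k
  · simp only [h, dite_true, WithLp.equiv_apply]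
    fun_prop
  · simp only [h, dite_false]
    exact continuous_const

lemma continuous_projK (N k : ℕ) : Continuous (projK N k) := by
  refine (PiLp.continuous_toLp 2 _).comp (continuous_pi fun j => ?_)
  by_cases h : (j : ℕ) < N
  · simp only [h, dite_true, WithLp.equiv_apply]
    fun_prop
  · simp only [h, dite_false]
    exact continuous_const

lemma projK_embedK {N k : ℕ} (hkN : k ≤ N) (x : EuclideanSpace ℝ (Fin k)) :
    projK N k (embedK N k x) = x := by
  ext j
  have : (j : ℕ) < N := j.isLt.trans_le hkN
  simp [projK, embedK, this]

lemma norm_sq_eq_of_blocks {N k : ℕ} (hkN : k ≤ N) (z : Euc N) (x : EuclideanSpace ℝ (Fin k))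
    (y : EuclideanSpace ℝ (Fin (N - k)))
    (hx : ∀ (i : Fin N) (h : (i : ℕ) < k), z i = x ⟨i, h⟩)
    (hy : ∀ (i : Fin N) (_ : ¬(i : ℕ) < k), z i = y ⟨(i : ℕ) - k, by have := i.isLt; omega⟩) :
    ‖z‖ ^ 2 = ‖x‖ ^ 2 + ‖y‖ ^ 2 := by
  rw [EuclideanSpace.norm_sq_eq, EuclideanSpace.norm_sq_eq, EuclideanSpace.norm_sq_eq,
    ← (finSumFinEquiv.trans (finCongr (Nat.add_sub_cancel' hkN))).sum_comp, Fintype.sum_sum_type]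
  congr 1
  · refine Finset.sum_congr rfl fun i _ => ?_
    rw [hx _ (by simp)]
    simp
  · refine Finset.sum_congr rfl fun i _ => ?_
    rw [hy _ (by simp)]
    simp

lemma norm_embedK {N k : ℕ} (hkN : k ≤ N) (x : EuclideanSpace ℝ (Fin k)) :
    ‖embedK N k x‖ = ‖x‖ := by
  have := norm_sq_eq_of_blocks hkN (embedK N k x) x 0
    (fun i h => by simp [embedK, h]) (fun i h => by simp [embedK, h])
  rw [norm_zero, zero_pow two_ne_zero, add_zero] at this
  exact (pow_left_inj₀ (norm_nonneg _) (norm_nonneg _) two_ne_zero).1 this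

lemma embedK_sub (N k : ℕ) (x y : EuclideanSpace ℝ (Fin k)) :
    embedK N k x - embedK N k y = embedK N k (x - y) := by
  ext i
  by_cases h : (i : ℕ) < k <;> simp [embedK, h]

lemma norm_sq_graphMap {N k : ℕ} (hkN : k ≤ N)
    (g : EuclideanSpace ℝ (Fin k) → EuclideanSpace ℝ (Fin (N - k)))
    (x : EuclideanSpace ℝ (Fin k)) :
    ‖graphMap N k g (embedK N k x)‖ ^ 2 = ‖x‖ ^ 2 + ‖g x‖ ^ 2 :=
  norm_sq_eq_of_blocks hkN _ _ _
    (fun i h => by simp [graphMap, embedK, h])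
    (fun i h => by
      simp only [graphMap, projK_embedK hkN]
      simp [h])

lemma norm_sq_graphMap_sub {N k : ℕ} (hkN : k ≤ N)
    (g : EuclideanSpace ℝ (Fin k) → EuclideanSpace ℝ (Fin (N - k)))
    (x y : EuclideanSpace ℝ (Fin k)) :
    ‖graphMap N k g (embedK N k x) - graphMap N k g (embedK N k y)‖ ^ 2
      = ‖x - y‖ ^ 2 + ‖g x - g y‖ ^ 2 :=
  norm_sq_eq_of_blocks hkN _ _ _
    (fun i h => by simp [graphMap, embedK, h])
    (fun i h => by
      simp only [graphMap, projK_embedK hkN]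
      simp [h])

lemma continuousOn_graphMap {N k : ℕ}
    {g : EuclideanSpace ℝ (Fin k) → EuclideanSpace ℝ (Fin (N - k))} {s : Set (Euc N)}
    {t : Set (EuclideanSpace ℝ (Fin k))} (hg : ContinuousOn g t) (hst : MapsTo (projK N k) s t) :
    ContinuousOn (graphMap N k g) s := by
  refine (PiLp.continuous_toLp 2 _).comp_continuousOn (continuousOn_pi.2 fun i => ?_)
  have hgp := hg.comp (continuous_projK N k).continuousOn hst
  by_cases h : (i : ℕ) < k
  · simp only [h, dite_true, WithLp.equiv_apply]
    fun_prop
  · simp only [h, dite_false, WithLp.equiv_apply]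
    exact (PiLp.continuous_apply 2 _ _).comp_continuousOn hgp

lemma isProbabilityMeasure_diskUnif (N k : ℕ) {ε : ℝ} (hε : 0 < ε) :
    IsProbabilityMeasure (diskUnif N k ε) := by
  have : IsProbabilityMeasure ((volume (closedBall (0 : EuclideanSpace ℝ (Fin k)) ε))⁻¹ •
      (volume : Measure (EuclideanSpace ℝ (Fin k))).restrict (closedBall 0 ε)) := by
    constructor
    rw [Measure.smul_apply, Measure.restrict_apply_univ, smul_eq_mul]
    exact ENNReal.inv_mul_cancel (measure_closedBall_pos _ _ hε).ne' measure_closedBall_lt_top.ne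
  exact Measure.isProbabilityMeasure_map (continuous_embedK N k).aemeasurable

lemma ae_diskUnif_mem (N k : ℕ) (ε : ℝ) :
    ∀ᵐ z ∂(diskUnif N k ε), z ∈ embedK N k '' closedBall 0 ε := by
  have hS := ((isCompact_closedBall (0 : EuclideanSpace ℝ (Fin k)) ε).image
    (continuous_embedK N k)).measurableSet
  refine (ae_map_iff (continuous_embedK N k).aemeasurable hS).2 (Measure.ae_smul_measure ?_ _)
  exact (ae_restrict_mem measurableSet_closedBall).mono fun x hx => mem_image_of_mem _ hx

lemma differentiableAt_of_radial {N : ℕ} (hN : 0 < N) {w : ℝ → ℝ} {W : Euc N → ℝ}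
    (hWw : ∀ x : Euc N, W x = w ‖x‖) (hW : Differentiable ℝ W) {r : ℝ} (hr : 0 < r) :
    DifferentiableAt ℝ w r := by
  let e : Euc N := EuclideanSpace.single ⟨0, hN⟩ 1
  have he : ‖e‖ = 1 := by simp [e]
  have hd : DifferentiableAt ℝ (fun t : ℝ => W (t • e)) r :=
    (hW _).comp r (by fun_prop)
  refine hd.congr_of_eventuallyEq ?_
  filter_upwards [lt_mem_nhds hr] with t ht
  rw [hWw, norm_smul, he, mul_one, Real.norm_of_nonneg ht.le]

/-- error estimate: for `W(x) = w(|x|)` C¹, decreasing near `0`, with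
`C*|w'(r)| ≤ r^{α-1}` on `[0,R]`, and `g` a `C²` graph with `g(0)=0`, `∇g(0)=0`, for all
small `ε > 0`:
`T[δ₀, P_g#ν_{ε,k}] - T[δ₀, ν_{ε,k}] ≤ (2^{α-1} ε^α / C*) ‖∇g‖_{L^∞(D^k_ε)}`. -/
theorem statement16 {N k : ℕ} (hk1 : 1 ≤ k) (hkN : k ≤ N) (α : ℝ) (hα : 2 < α)
    (w : ℝ → ℝ) (W : Euc N → ℝ) (hWw : ∀ x : Euc N, W x = w ‖x‖) (hW : ContDiff ℝ 1 W)
    (r₀ : ℝ) (hr₀ : 0 < r₀) (hdec : AntitoneOn w (Icc 0 r₀))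
    (Cstar R : ℝ) (hCstar : 0 < Cstar) (hR : 0 < R)
    (hw' : ∀ r ∈ Icc (0 : ℝ) R, Cstar * |deriv w r| ≤ r ^ (α - 1))
    (g : EuclideanSpace ℝ (Fin k) → EuclideanSpace ℝ (Fin (N - k)))
    (hg : ContDiffOn ℝ 2 g (closedBall 0 R)) (hg0 : g 0 = 0) (hg'0 : fderiv ℝ g 0 = 0) :
    ∃ ε₀ > 0, ∀ ε : ℝ, 0 < ε → ε < ε₀ →
      Tform (fun x => ((W x : ℝ) : EReal)) (Measure.dirac 0)
          ((diskUnif N k ε).map (graphMap N k g))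
        - Tform (fun x => ((W x : ℝ) : EReal)) (Measure.dirac 0) (diskUnif N k ε)
      ≤ (((2 ^ (α - 1) * ε ^ α / Cstar) *
          (⨆ x ∈ closedBall (0 : EuclideanSpace ℝ (Fin k)) ε, ‖fderiv ℝ g x‖) : ℝ) : EReal) := by
  have hgU : ContDiffOn ℝ 2 g (ball 0 R) := hg.mono ball_subset_closedBall
  have hdiff : ∀ x ∈ ball (0 : EuclideanSpace ℝ (Fin k)) R, DifferentiableAt ℝ g x := fun x hx =>
    (hgU.differentiableOn (by norm_num)).differentiableAt (isOpen_ball.mem_nhds hx)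
  have hcont : ContinuousAt (fderiv ℝ g) 0 :=
    (hgU.continuousOn_fderiv_of_isOpen isOpen_ball (by norm_num)).continuousAt
      (ball_mem_nhds _ hR)
  obtain ⟨δ, hδ, hδ1⟩ := Metric.continuousAt_iff.1 hcont 1 one_pos
  refine ⟨min δ (min (R / 2) (r₀ / 4)), by positivity, fun ε hε hεlt => ?_⟩
  obtain ⟨hεδ, hεR, hεr⟩ : ε < δ ∧ ε < R / 2 ∧ ε < r₀ / 4 := by simpa using hεlt
  have hle1 : ∀ x ∈ closedBall (0 : EuclideanSpace ℝ (Fin k)) ε, ‖fderiv ℝ g x‖ ≤ 1 := by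
    intro x hx
    have := hδ1 ((mem_closedBall.1 hx).trans_lt hεδ)
    rw [hg'0, dist_zero_right] at this
    exact this.le
  set L := ⨆ x ∈ closedBall (0 : EuclideanSpace ℝ (Fin k)) ε, ‖fderiv ℝ g x‖ with hL
  have hinner : ∀ x : EuclideanSpace ℝ (Fin k),
      ⨆ (_ : x ∈ closedBall (0 : EuclideanSpace ℝ (Fin k)) ε), ‖fderiv ℝ g x‖ ≤ 1 :=
    fun x => Real.iSup_le (hle1 x) zero_le_one
  have hL1 : L ≤ 1 := Real.iSup_le hinner zero_le_one
  have hL0 : 0 ≤ L := Real.iSup_nonneg fun x => Real.iSup_nonneg fun _ => norm_nonneg _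
  have hleL : ∀ x ∈ closedBall (0 : EuclideanSpace ℝ (Fin k)) ε, ‖fderiv ℝ g x‖ ≤ L :=
    fun x hx => le_ciSup_of_le ⟨1, forall_mem_range.2 hinner⟩ x
      (by simp only [hx, ciSup_unique]; rfl)
  have hsub : closedBall (0 : EuclideanSpace ℝ (Fin k)) ε ⊆ ball 0 R :=
    closedBall_subset_ball (by linarith)
  have hgL : ∀ x ∈ closedBall (0 : EuclideanSpace ℝ (Fin k)) ε, ‖g x‖ ≤ L * ‖x‖ := by
    intro x hx
    simpa [hg0] using (convex_closedBall
      (0 : EuclideanSpace ℝ (Fin k)) ε).norm_image_sub_le_of_norm_fderiv_le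
      (fun y hy => hdiff y (hsub hy)) hleL (mem_closedBall_self hε.le) hx
  have hPlow : ∀ x, ‖x‖ ≤ ‖graphMap N k g (embedK N k x)‖ := fun x =>
    (sq_le_sq₀ (norm_nonneg _) (norm_nonneg _)).1
      (by rw [norm_sq_graphMap hkN]; exact le_add_of_nonneg_right (sq_nonneg _))
  have hPup : ∀ x, ‖graphMap N k g (embedK N k x)‖ ≤ ‖x‖ + ‖g x‖ := fun x =>
    (sq_le_sq₀ (norm_nonneg _) (by positivity)).1
      (by rw [norm_sq_graphMap hkN]; nlinarith [norm_nonneg x, norm_nonneg (g x)])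
  have hP2 : ∀ x ∈ closedBall (0 : EuclideanSpace ℝ (Fin k)) ε,
      ‖graphMap N k g (embedK N k x)‖ ≤ 2 * ε := by
    intro x hx
    have hxε : ‖x‖ ≤ ε := by simpa using hx
    nlinarith [hPup x, hgL x hx, norm_nonneg x]
  have := isProbabilityMeasure_diskUnif N k hε
  have hmeas : MeasurableSet (embedK N k '' closedBall 0 ε) :=
    ((isCompact_closedBall _ ε).image (continuous_embedK N k)).measurableSet
  have hP : AEMeasurable (graphMap N k g) (diskUnif N k ε) := by
    rw [← Measure.restrict_eq_self_of_ae_mem (ae_diskUnif_mem N k ε)]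
    refine (continuousOn_graphMap hg.continuousOn ?_).aemeasurable hmeas
    rintro _ ⟨x, hx, rfl⟩
    rw [projK_embedK hkN]
    exact ball_subset_closedBall (hsub hx)
  refine Tform_map_sub_le hW.continuous (fun x => by simp [hWw]) hP (ae_diskUnif_mem N k ε)
    (M := 2 * ε) (by positivity) ?_ ?_ ?_ ?_
  · rintro _ ⟨x, hx, rfl⟩
    have hxε : ‖x‖ ≤ ε := by simpa using hx
    rw [norm_embedK hkN]
    linarith
  · rintro _ ⟨x, hx, rfl⟩
    exact hP2 x hx
  · rintro _ ⟨x, hx, rfl⟩ _ ⟨y, hy, rfl⟩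
    have hle : ‖x - y‖ ≤ ‖graphMap N k g (embedK N k x) - graphMap N k g (embedK N k y)‖ :=
      (sq_le_sq₀ (norm_nonneg _) (norm_nonneg _)).1
        (by rw [norm_sq_graphMap_sub hkN]; exact le_add_of_nonneg_right (sq_nonneg _))
    have hup := (norm_sub_le (graphMap N k g (embedK N k x))
      (graphMap N k g (embedK N k y))).trans (add_le_add (hP2 x hx) (hP2 y hy))
    rw [hWw, hWw, embedK_sub, norm_embedK hkN]
    exact hdec ⟨norm_nonneg _, by linarith⟩ ⟨norm_nonneg _, by linarith⟩ hle
  · rintro _ ⟨x, hx, rfl⟩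
    have hxε : ‖x‖ ≤ ε := by simpa using hx
    rw [hWw, hWw, norm_embedK hkN]
    rcases (norm_nonneg x).eq_or_lt with h0 | hpos
    · have hz : ‖graphMap N k g (embedK N k x)‖ = 0 :=
        le_antisymm (by nlinarith [hPup x, hgL x hx]) (norm_nonneg _)
      rw [hz, ← h0, sub_self]
      positivity
    have hder : ∀ r ∈ Icc ‖x‖ ‖graphMap N k g (embedK N k x)‖,
        ‖deriv w r‖ ≤ (2 * ε) ^ (α - 1) / Cstar := by
      intro r hr
      have hr0 : 0 ≤ r := hpos.le.trans hr.1
      have hr2 : r ≤ 2 * ε := hr.2.trans (hP2 x hx)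
      rw [Real.norm_eq_abs, le_div_iff₀' hCstar]
      exact (hw' r ⟨hr0, by linarith⟩).trans (Real.rpow_le_rpow hr0 hr2 (by linarith))
    have hmvt := (convex_Icc ‖x‖ ‖graphMap N k g (embedK N k x)‖).norm_image_sub_le_of_norm_deriv_le
      (fun r hr => differentiableAt_of_radial (hk1.trans hkN) hWw
        (hW.differentiable one_ne_zero) (hpos.trans_le hr.1)) hder
      (right_mem_Icc.2 (hPlow x)) (left_mem_Icc.2 (hPlow x))
    have hlen : ‖‖x‖ - ‖graphMap N k g (embedK N k x)‖‖ ≤ L * ε := by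
      rw [norm_sub_rev, Real.norm_of_nonneg (sub_nonneg.2 (hPlow x))]
      nlinarith [hPup x, hgL x hx]
    calc _ ≤ (2 * ε) ^ (α - 1) / Cstar * (L * ε) :=
          (le_abs_self _).trans (hmvt.trans (by gcongr))
      _ = 2 ^ (α - 1) * ε ^ α / Cstar * L := by
          rw [Real.mul_rpow zero_le_two hε.le, Real.rpow_sub_one hε.ne' α]
          field_simp


end
end
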